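/- arXiv:2410.22860 — 8 statements merged into one kernel-verified Lean document; each statement's English description precedes it below -/
import Mathlib

section
/- For every t ≥ t0 the Richards growth curve satisfies the autonomous differential equation d/dt x_θ(t) = q·|log k|·x_θ(t)·[1 − (η/(η+k^{t0}))·(x_θ(t)/x0)^{1/q}]. -/
/-- For every `t ≥ t0` the Richards growth curve satisfies the autonomous ODE
`x' t = q * |log k| * x t * (1 - η/(η + k^t0) * (x t / x0)^(1/q))`. -/
theorem stmt_2 (q k η x0 t0 : ℝ) (hq : 0 < q) (hk0 : 0 < k) (hk1 : k < 1)
    (hη : 0 < η) (hx0 : 0 < x0)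
    (x : ℝ → ℝ)
    (hx : ∀ t, x t = x0 * ((η + k ^ t0) / (η + k ^ t)) ^ q) :
    ∀ t, t0 ≤ t →
      HasDerivAt x
        (q * |Real.log k| * x t * (1 - η / (η + k ^ t0) * (x t / x0) ^ (1 / q))) t := by
  intro t _
  have hA : 0 < η + k ^ t0 := by positivity
  have hD : 0 < η + k ^ t := by positivity
  have hr : 0 < (η + k ^ t0) / (η + k ^ t) := div_pos hA hD
  have hroot : (x t / x0) ^ (1 / q) = (η + k ^ t0) / (η + k ^ t) := by
    rw [hx, mul_div_cancel_left₀ _ hx0.ne', one_div, Real.rpow_rpow_inv hr.le hq.ne']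
  have hpow : HasDerivAt (fun s : ℝ => η + k ^ s) (k ^ t * Real.log k) t := by
    simpa [mul_comm] using ((hasDerivAt_id t).const_rpow hk0).const_add η
  have hquot := (hasDerivAt_const t (η + k ^ t0)).fun_div hpow hD.ne'
  have hmain := (hquot.rpow_const (p := q) (Or.inl hr.ne')).const_mul x0
  rw [hroot, abs_of_neg (Real.log_neg hk0 hk1), hx t, funext hx]
  refine hmain.congr_deriv ?_
  rw [Real.rpow_sub_one hr.ne']
  field_simp
  ring
end

section
/- The ratio between the carrying capacity of the Richards growth curve and its value at the inflection point equals (1+1/q)^q, i.e. K_θ/x_θ(t_I) = (1+1/q)^q, and the function q ↦ (1+1/q)^q is strictly increasing on (0,∞). -/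
/-- The function `r ↦ (1 + 1/r)^r` is strictly increasing on the positive reals. -/
theorem strictMonoOn_one_add_one_div_rpow :
    StrictMonoOn (fun r : ℝ => (1 + 1 / r) ^ r) (Set.Ioi (0 : ℝ)) := by
  intro a ha b hb hab
  have ha : 0 < a := ha
  have hb : 0 < b := hb
  have hinv : 0 < 1 / b := by positivity
  have bernoulli : 1 + b / a * (1 / b) < (1 + 1 / b) ^ (b / a) :=
    one_add_mul_self_lt_rpow_one_add (by linarith) hinv.ne' ((one_lt_div ha).2 hab)
  rw [show b / a * (1 / b) = 1 / a by field_simp] at bernoulli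
  calc (1 + 1 / a) ^ a < ((1 + 1 / b) ^ (b / a)) ^ a :=
        Real.rpow_lt_rpow (by positivity) bernoulli ha
    _ = (1 + 1 / b) ^ b := by
        rw [← Real.rpow_mul (by positivity), div_mul_cancel₀ b ha.ne']

/-- Exponentiation inverts the change-of-base quotient of logarithms. -/
theorem rpow_log_div_log {k y : ℝ} (hk0 : 0 < k) (hk1 : k ≠ 1) (hy : 0 < y) :
    k ^ (Real.log y / Real.log k) = y :=
  Real.rpow_logb hk0 hk1 hy

/-- The ratio between the carrying capacity of the Richards growth curve and its value at the
inflection point equals `(1 + 1/q)^q`, and `q ↦ (1 + 1/q)^q` is strictly increasing on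
`(0, ∞)`. -/
theorem stmt_6 (q k η x0 t0 : ℝ) (hq : 0 < q) (hk0 : 0 < k) (hk1 : k < 1)
    (hη : 0 < η) (hx0 : 0 < x0)
    (x : ℝ → ℝ)
    (hx : ∀ t, x t = x0 * ((η + k ^ t0) / (η + k ^ t)) ^ q)
    (tI K : ℝ)
    (htI : tI = Real.log (η / q) / Real.log k)
    (hK : K = x0 * (1 + k ^ t0 / η) ^ q) :
    K / x tI = (1 + 1 / q) ^ q ∧
    StrictMonoOn (fun r : ℝ => (1 + 1 / r) ^ r) (Set.Ioi (0 : ℝ)) := by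
  refine ⟨?_, strictMonoOn_one_add_one_div_rpow⟩
  have hc : 0 < k ^ t0 := Real.rpow_pos_of_pos hk0 t0
  rw [hx, hK, htI, rpow_log_div_log hk0 hk1.ne (div_pos hη hq),
    mul_div_mul_left _ _ hx0.ne', ← Real.div_rpow (by positivity) (by positivity)]
  congr 1
  field_simp
end

section
/- The derivative of the Richards growth curve at the inflection time t_I = log(η/q)/log k equals the maximum specific growth rate μ = (η+k^{t0})^q · x0·|log k|/η^q · (q/(q+1))^{q+1} > 0, and the tangent line t ↦ x_θ(t_I) + μ·(t−t_I) to the curve at t_I crosses the horizontal axis exactly at the lag time λ = t_I − (1+1/q)/|log k|, which satisfies λ < t_I. -/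
/-- The logarithmic derivative of the Richards curve is `-q * log k * k ^ t / (η + k ^ t)`. -/
theorem hasDerivAt_richards {q k η A x0 : ℝ} (hk : 0 < k) (hη : 0 < η) (hA : 0 < A) (t : ℝ) :
    HasDerivAt (fun t : ℝ => x0 * (A / (η + k ^ t)) ^ q)
      (x0 * (A / (η + k ^ t)) ^ q * (q * -Real.log k * (k ^ t / (η + k ^ t)))) t := by
  have hden : 0 < η + k ^ t := by positivity
  have hd : HasDerivAt (fun t : ℝ => η + k ^ t) (k ^ t * Real.log k) t :=
    (Real.hasStrictDerivAt_const_rpow hk t).hasDerivAt.const_add η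
  have hpow := ((((hasDerivAt_const t A).fun_div hd hden.ne').rpow_const
    (p := q) (Or.inl (div_pos hA hden).ne')).const_mul x0)
  refine hpow.congr_deriv ?_
  rw [Real.rpow_sub_one (div_pos hA hden).ne']
  field_simp
  ring


/-- The derivative of the Richards growth curve at the inflection time `tI = log(η/q)/log k`
equals the maximum specific growth rate
`μ = (η + k^t0)^q * x0 * |log k| / η^q * (q/(q+1))^(q+1) > 0`, and the tangent line
`t ↦ x tI + μ * (t - tI)` crosses the horizontal axis exactly at the lag time
`lam = tI - (1 + 1/q)/|log k|`, which satisfies `lam < tI`. -/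
theorem stmt_7 (q k η x0 t0 : ℝ) (hq : 0 < q) (hk0 : 0 < k) (hk1 : k < 1)
    (hη : 0 < η) (hx0 : 0 < x0)
    (x : ℝ → ℝ)
    (hx : ∀ t, x t = x0 * ((η + k ^ t0) / (η + k ^ t)) ^ q)
    (tI μ lam : ℝ)
    (htI : tI = Real.log (η / q) / Real.log k)
    (hμ : μ = (η + k ^ t0) ^ q * (x0 * |Real.log k| / η ^ q) * (q / (q + 1)) ^ (q + 1))
    (hlam : lam = tI - (1 + 1 / q) / |Real.log k|) :
    HasDerivAt x μ tI ∧
    0 < μ ∧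
    x tI + μ * (lam - tI) = 0 ∧
    (∀ t : ℝ, x tI + μ * (t - tI) = 0 → t = lam) ∧
    lam < tI := by
  have hlogk : Real.log k < 0 := Real.log_neg hk0 hk1
  have habs : |Real.log k| = -Real.log k := abs_of_neg hlogk
  have hL : 0 < |Real.log k| := abs_pos.mpr hlogk.ne
  have hA : 0 < η + k ^ t0 := by positivity
  have hktI : k ^ tI = η / q := by
    rw [Real.rpow_def_of_pos hk0, htI, mul_div_cancel₀ _ hlogk.ne, Real.exp_log (by positivity)]
  have hxtI : x tI = x0 * ((η + k ^ t0) ^ q / η ^ q * (q / (q + 1)) ^ q) := by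
    have hfrac : (η + k ^ t0) / (η + η / q) = (η + k ^ t0) / η * (q / (q + 1)) := by
      field_simp
    rw [hx, hktI, hfrac, Real.mul_rpow (by positivity) (by positivity),
      Real.div_rpow hA.le hη.le]
  have hμx : μ = x tI * (|Real.log k| * (q / (q + 1))) := by
    rw [hμ, hxtI, Real.rpow_add_one (by positivity)]
    ring
  have hμ_pos : 0 < μ := by
    rw [hμ]
    positivity
  have hzero : x tI + μ * (lam - tI) = 0 := by
    rw [hμx, hlam]
    field_simp
    ring
  refine ⟨?_, hμ_pos, hzero, fun t ht => ?_, ?_⟩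
  · have hderiv := hasDerivAt_richards (q := q) (x0 := x0) hk0 hη hA tI
    rw [← hx, ← funext hx] at hderiv
    refine hderiv.congr_deriv ?_
    rw [hμx, hktI, habs]
    field_simp
  · have heq : μ * (t - lam) = 0 := by linear_combination ht - hzero
    exact sub_eq_zero.mp ((mul_eq_zero.mp heq).resolve_left hμ_pos.ne')
  · rw [hlam]
    exact sub_lt_self _ (by positivity)
end

section
/- Fix p>0 and t ≥ t0, and suppose the boundary value B(t) = (1+p)·x_θ(t) is strictly smaller than the carrying capacity K_θ. Then the quantity θ_t = (1/log k)·log((η+k^t)·(1+p)^{−1/q} − η) is well defined (the argument of the logarithm is positive), it satisfies x_θ(θ_t) = B(t), and it is the unique real number s with x_θ(s) = B(t). -/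
/-- Fix `p > 0` and `t ≥ t0`, and suppose the boundary value `B = (1+p) * x t` is strictly
smaller than the carrying capacity `K`. Then
`θt = (1/log k) * log((η + k^t) * (1+p)^(-1/q) - η)` is well defined (the argument of the
logarithm is positive), it satisfies `x θt = B`, and it is the unique real `s` with
`x s = B`. -/
theorem stmt_8 (q k η x0 t0 p t : ℝ) (hq : 0 < q) (hk0 : 0 < k) (hk1 : k < 1)
    (hη : 0 < η) (hx0 : 0 < x0) (hp : 0 < p) (ht : t0 ≤ t)
    (x : ℝ → ℝ)
    (hx : ∀ s, x s = x0 * ((η + k ^ t0) / (η + k ^ s)) ^ q)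
    (K B θt : ℝ)
    (hK : K = x0 * (1 + k ^ t0 / η) ^ q)
    (hB : B = (1 + p) * x t)
    (hBK : B < K)
    (hθ : θt = (1 / Real.log k) * Real.log ((η + k ^ t) * (1 + p) ^ (-(1 / q)) - η)) :
    0 < (η + k ^ t) * (1 + p) ^ (-(1 / q)) - η ∧
    x θt = B ∧
    ∀ s : ℝ, x s = B → s = θt := by
  have hlog : Real.log k < 0 := Real.log_neg hk0 hk1
  have hA : 0 < η + k ^ t0 := add_pos hη (Real.rpow_pos_of_pos hk0 t0)
  have hD : 0 < η + k ^ t := add_pos hη (Real.rpow_pos_of_pos hk0 t)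
  have hp1 : 0 < 1 + p := by linarith
  have hc : 0 < (1 + p) ^ (-(1 / q)) := Real.rpow_pos_of_pos hp1 _
  have hcq : ((1 + p) ^ (-(1 / q))) ^ q = (1 + p)⁻¹ := by
    rw [← Real.rpow_mul hp1.le, neg_mul, one_div_mul_cancel hq.ne', Real.rpow_neg_one]
  set A := η + k ^ t0 with hAdef
  set D := η + k ^ t with hDdef
  set c := (1 + p) ^ (-(1 / q)) with hcdef
  have hDc : 0 < D * c := mul_pos hD hc
  have hB' : B = x0 * (A / (D * c)) ^ q := by
    rw [hB, hx, ← div_div, Real.div_rpow (div_pos hA hD).le hc.le, hcq, div_inv_eq_mul]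
    ring
  have hK' : K = x0 * (A / η) ^ q := by
    rw [hK, hAdef, add_div, div_self hη.ne']
  have hpos : 0 < D * c - η := by
    rw [hB', hK'] at hBK
    have h := (Real.rpow_lt_rpow_iff (div_pos hA hDc).le (div_pos hA hη).le hq).1
      (lt_of_mul_lt_mul_left hBK hx0.le)
    exact sub_pos.2 ((div_lt_div_iff_of_pos_left hA hDc hη).1 h)
  refine ⟨hpos, ?_, fun s hs => ?_⟩
  · have hpow : k ^ θt = D * c - η := by
      rw [Real.rpow_def_of_pos hk0, hθ, ← mul_assoc, mul_one_div_cancel hlog.ne, one_mul,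
        Real.exp_log hpos]
    rw [hx, hB', hpow, add_sub_cancel]
  · have hS : 0 < η + k ^ s := add_pos hη (Real.rpow_pos_of_pos hk0 s)
    rw [hx, hB'] at hs
    have h := (Real.rpow_left_inj (div_pos hA hS).le (div_pos hA hDc).le hq.ne').1
      (mul_left_cancel₀ hx0.ne' hs)
    have hSD : η + k ^ s = D * c := by
      rw [div_eq_div_iff hS.ne' hDc.ne'] at h
      exact (mul_left_cancel₀ hA.ne' h).symm
    rw [hθ, ← hSD, add_sub_cancel_left, Real.log_rpow hk0]
    field_simp [hlog.ne]
end

section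
/- Fix p>0 with (1+p)·x_θ(t_I) < K_θ, where t_I = log(η/q)/log k is the inflection time. Then the switching time t* = t_I + log((1+q)·(1+p)^{−1/q} − q)/log k is well defined, satisfies x_θ(t*) = (1+p)·x_θ(t_I), and t* > t_I. -/
/-- Fix `p > 0` with `(1+p) * x tI < K`, where `tI = log(η/q)/log k` is the inflection time.
Then the switching time `tstar = tI + log((1+q) * (1+p)^(-1/q) - q)/log k` is well defined,
satisfies `x tstar = (1+p) * x tI`, and `tstar > tI`. -/
theorem stmt_9 (q k η x0 t0 p : ℝ) (hq : 0 < q) (hk0 : 0 < k) (hk1 : k < 1)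
    (hη : 0 < η) (hx0 : 0 < x0) (hp : 0 < p)
    (x : ℝ → ℝ)
    (hx : ∀ s, x s = x0 * ((η + k ^ t0) / (η + k ^ s)) ^ q)
    (K tI tstar : ℝ)
    (hK : K = x0 * (1 + k ^ t0 / η) ^ q)
    (htI : tI = Real.log (η / q) / Real.log k)
    (hBK : (1 + p) * x tI < K)
    (hts : tstar = tI + Real.log ((1 + q) * (1 + p) ^ (-(1 / q)) - q) / Real.log k) :
    0 < (1 + q) * (1 + p) ^ (-(1 / q)) - q ∧
    x tstar = (1 + p) * x tI ∧
    tI < tstar := by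
  have hlogk : Real.log k < 0 := Real.log_neg hk0 hk1
  have hpow {y : ℝ} (hy : 0 < y) : k ^ (Real.log y / Real.log k) = y := by
    rw [Real.rpow_def_of_pos hk0, mul_div_cancel₀ _ hlogk.ne, Real.exp_log hy]
  obtain ⟨u, hu⟩ : ∃ u : ℝ, u = (1 + p) ^ (1 / q) := ⟨_, rfl⟩
  have hp1 : 0 < 1 + p := by linarith
  have hu1 : 1 < u := hu ▸ Real.one_lt_rpow (by linarith) (by positivity)
  have hu0 : 0 < u := by linarith
  have huq : u ^ q = 1 + p := by
    rw [hu, ← Real.rpow_mul hp1.le, one_div_mul_cancel hq.ne', Real.rpow_one]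
  have hkI : k ^ tI = η / q := by rw [htI, hpow (by positivity)]
  have hA : 0 < η + k ^ t0 := by positivity
  have hscale : (1 + p) * x tI = x0 * (u * ((η + k ^ t0) / (η + η / q))) ^ q := by
    rw [hx, hkI, Real.mul_rpow hu0.le (by positivity), huq]
    ring
  have hu_lt : u * q < 1 + q := by
    rw [hscale, hK] at hBK
    have h := (Real.rpow_lt_rpow_iff (by positivity) (by positivity) hq).mp
      (lt_of_mul_lt_mul_left hBK hx0.le)
    have h1 : u * ((η + k ^ t0) / (η + η / q)) = u * q / (1 + q) * ((η + k ^ t0) / η) := by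
      field_simp
      ring
    have h2 : 1 + k ^ t0 / η = 1 * ((η + k ^ t0) / η) := by
      field_simp
    rw [h1, h2] at h
    exact (div_lt_one (by positivity)).mp (lt_of_mul_lt_mul_right h (by positivity))
  rw [Real.rpow_neg hp1.le, ← hu, ← div_eq_mul_inv] at hts ⊢
  have hc0 : 0 < (1 + q) / u - q := by
    rw [sub_pos, lt_div_iff₀ hu0]
    linarith
  have hc1 : (1 + q) / u - q < 1 := by
    have : (1 + q) / u < 1 + q := div_lt_self (by positivity) hu1
    linarith
  refine ⟨hc0, ?_, ?_⟩
  · have hden : η + k ^ tstar = (η + η / q) / u := by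
      rw [hts, Real.rpow_add hk0, hkI, hpow hc0]
      field_simp
      ring
    rw [hscale, hx, hden, div_div_eq_mul_div, mul_comm (η + k ^ t0) u, mul_div_assoc]
  · rw [hts]
    exact lt_add_of_pos_right _ (div_pos_of_neg_of_neg (Real.log_neg hc0 hc1) hlogk)
end

section
/- The modified Richards curve has finite carrying capacity K̃_θ = lim_{t→∞} x̃_θ(t) = K_θ·exp(∫_{t*}^{∞} C(s)·k^s·|log k|/(η+k^s) ds): the improper integral converges (since C is bounded), the limit exists and equals this expression, and K̃_θ > K_θ. -/
open MeasureTheory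

/-- The weight `k ^ s * |log k| / (η + k ^ s)` decays exponentially, so it is integrable at infinity
against any bounded continuous function. -/
theorem integrableOn_mul_rpow_mul_abs_log_div {k η a M : ℝ} {C : ℝ → ℝ} (hk0 : 0 < k) (hk1 : k < 1)
    (hη : 0 < η) (hC : ContinuousOn C (Set.Ici a)) (hM : ∀ t, a ≤ t → |C t| ≤ M) :
    IntegrableOn (fun s => C s * (k ^ s) * |Real.log k| / (η + k ^ s)) (Set.Ioi a) := by
  have hkc : Continuous fun s : ℝ => k ^ s := Real.continuous_const_rpow hk0.ne'
  have hdom : IntegrableOn (fun s : ℝ => M * |Real.log k| / η * k ^ s) (Set.Ioi a) := by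
    simp only [Real.rpow_def_of_pos hk0]
    exact (integrableOn_exp_mul_Ioi (Real.log_neg hk0 hk1) a).const_mul _
  have hcont : ContinuousOn (fun s => C s * (k ^ s) * |Real.log k| / (η + k ^ s)) (Set.Ioi a) :=
    (((hC.mono Set.Ioi_subset_Ici_self).mul hkc.continuousOn).mul continuousOn_const).div
      (continuousOn_const.add hkc.continuousOn)
      fun s _ => (add_pos hη (Real.rpow_pos_of_pos hk0 s)).ne'
  refine hdom.mono' (hcont.aestronglyMeasurable measurableSet_Ioi) ?_
  filter_upwards [ae_restrict_mem measurableSet_Ioi] with s hs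
  have hks : 0 < k ^ s := Real.rpow_pos_of_pos hk0 s
  have hCs : |C s| ≤ M := hM s (le_of_lt hs)
  have hM0 : 0 ≤ M := (abs_nonneg _).trans hCs
  rw [Real.norm_eq_abs, abs_div, abs_mul, abs_mul, abs_abs, abs_of_pos hks,
    abs_of_pos (add_pos hη hks)]
  calc |C s| * k ^ s * |Real.log k| / (η + k ^ s) ≤ M * k ^ s * |Real.log k| / η := by
        gcongr
        linarith
    _ = M * |Real.log k| / η * k ^ s := by ring

/-- The Richards curve tends to its carrying capacity. -/
theorem tendsto_richards {q k η : ℝ} (x0 t0 : ℝ) (hq : 0 < q) (hk0 : 0 < k) (hk1 : k < 1)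
    (hη : 0 < η) :
    Filter.Tendsto (fun t : ℝ => x0 * ((η + k ^ t0) / (η + k ^ t)) ^ q) Filter.atTop
      (nhds (x0 * (1 + k ^ t0 / η) ^ q)) := by
  have hk : Filter.Tendsto (fun t : ℝ => η + k ^ t) Filter.atTop (nhds η) := by
    simpa using (tendsto_rpow_atTop_of_base_lt_one k (by linarith) hk1).const_add η
  have hη' : 1 + k ^ t0 / η = (η + k ^ t0) / η := by field_simp
  rw [hη']
  exact ((tendsto_const_nhds.div hk hη.ne').rpow_const (Or.inr hq.le)).const_mul x0

/-- The modified Richards curve has finite carrying capacity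
`Kt = K * exp(∫_{tstar}^∞ C s * k^s * |log k| / (η + k^s) ds)`: the improper integral
converges, the limit of the curve as `t → ∞` exists and equals this expression, and
`Kt > K`. -/
theorem stmt_12 (q k η x0 t0 tstar : ℝ) (hq : 0 < q) (hk0 : 0 < k) (hk1 : k < 1)
    (hη : 0 < η) (hx0 : 0 < x0) (htstar : t0 ≤ tstar)
    (C : ℝ → ℝ)
    (hC_cont : ContinuousOn C (Set.Ici tstar))
    (hC_bdd : ∃ M : ℝ, ∀ t, tstar ≤ t → |C t| ≤ M)
    (hC_pos : ∀ t, tstar < t → 0 < C t)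
    (hC_zero : C tstar = 0)
    (x xt : ℝ → ℝ)
    (hx : ∀ t, x t = x0 * ((η + k ^ t0) / (η + k ^ t)) ^ q)
    (hxt : ∀ t, xt t =
      x t * Real.exp (∫ s in tstar..max t tstar, C s * (k ^ s) * |Real.log k| / (η + k ^ s)))
    (K Kt : ℝ)
    (hK : K = x0 * (1 + k ^ t0 / η) ^ q)
    (hKt : Kt = K * Real.exp (∫ s in Set.Ioi tstar, C s * (k ^ s) * |Real.log k| / (η + k ^ s))) :
    IntegrableOn (fun s => C s * (k ^ s) * |Real.log k| / (η + k ^ s)) (Set.Ioi tstar) ∧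
    Filter.Tendsto xt Filter.atTop (nhds Kt) ∧
    K < Kt := by
  obtain ⟨M, hM⟩ := hC_bdd
  have hint := integrableOn_mul_rpow_mul_abs_log_div hk0 hk1 hη hC_cont hM
  refine ⟨hint, ?_, ?_⟩
  · have hmax : Filter.Tendsto (fun t : ℝ => max t tstar) Filter.atTop Filter.atTop :=
      Filter.tendsto_atTop_mono (fun t => le_max_left t tstar) Filter.tendsto_id
    rw [hKt, hK, funext hxt]
    simp only [hx]
    exact (tendsto_richards x0 t0 hq hk0 hk1 hη).mul
      ((Real.continuous_exp.tendsto _).comp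
        (intervalIntegral_tendsto_integral_Ioi tstar hint hmax))
  · have hpos : ∀ s ∈ Set.Ioi tstar, 0 < C s * (k ^ s) * |Real.log k| / (η + k ^ s) := fun s hs => by
      have hCs := hC_pos s hs
      have hlog : 0 < |Real.log k| := abs_pos.mpr (Real.log_neg hk0 hk1).ne
      positivity
    have hI : 0 < ∫ s in Set.Ioi tstar, C s * (k ^ s) * |Real.log k| / (η + k ^ s) := by
      rw [setIntegral_pos_iff_support_of_nonneg_ae
        ((ae_restrict_mem measurableSet_Ioi).mono fun s hs => (hpos s hs).le) hint,
        Set.inter_eq_right.mpr fun s hs => Function.mem_support.mpr (hpos s hs).ne']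
      simp
    have hK0 : 0 < K := by rw [hK]; positivity
    rw [hKt]
    exact lt_mul_of_one_lt_right hK0 (Real.one_lt_exp_iff.mpr hI)
end

section
/- Define ψ(t) = ((η+k^t)/(η+1))^q · exp(−∫_{t*}^{max(t,t*)} C(s)·k^s·|log k|/(η+k^s) ds) and the Fano factor D(t) = 1/ψ(t) − 1 for t ≥ 0. Then ψ is strictly decreasing on [0,∞), D is strictly increasing on [0,∞), D(0) = 0, and lim_{t→∞} D(t) = K̃/y − 1, where K̃ = y·((η+1)/η)^q · exp(∫_{t*}^{∞} C(s)·k^s·|log k|/(η+k^s) ds); moreover the coefficient of variation σ_y(t) = sqrt((1−ψ(t))/y) is increasing in t with σ_y(0)=0 and lim_{t→∞} σ_y(t) = sqrt((K̃−y)/(K̃·y)). -/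
open MeasureTheory

/-- The integrand `C s * k ^ s * |log k| / (η + k ^ s)` is integrable on `(a, ∞)` when `C` is
continuous and bounded there. -/
lemma integrableOn_mul_rpow_div_add_rpow {k η a : ℝ} (hk0 : 0 < k) (hk1 : k < 1) (hη : 0 < η)
    {C : ℝ → ℝ} (hC : ContinuousOn C (Set.Ici a)) {M : ℝ} (hM : ∀ t, a ≤ t → |C t| ≤ M) :
    IntegrableOn (fun s => C s * (k ^ s) * |Real.log k| / (η + k ^ s)) (Set.Ioi a) := by
  have hpos : ∀ s : ℝ, 0 < k ^ s := fun s => Real.rpow_pos_of_pos hk0 s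
  have hcont : ContinuousOn (fun s => C s * (k ^ s) * |Real.log k| / (η + k ^ s))
      (Set.Ici a) := by
    have hk : Continuous fun s : ℝ => k ^ s := Real.continuous_const_rpow hk0.ne'
    refine ((hC.mul hk.continuousOn).mul continuousOn_const).div
      (continuousOn_const.add hk.continuousOn) fun s _ => ?_
    have := hpos s
    positivity
  have hexp : IntegrableOn (fun s : ℝ => M * |Real.log k| / η * Real.exp (Real.log k * s))
      (Set.Ioi a) :=
    (integrableOn_exp_mul_Ioi (Real.log_neg hk0 hk1) a).const_mul _
  refine Integrable.mono' hexp
    ((hcont.mono Set.Ioi_subset_Ici_self).aestronglyMeasurable measurableSet_Ioi) ?_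
  refine (ae_restrict_iff' measurableSet_Ioi).2 (Filter.Eventually.of_forall fun s hs => ?_)
  have hks := hpos s
  have hden : 0 < η + k ^ s := by positivity
  have hCs := hM s (le_of_lt hs)
  have hM0 : 0 ≤ M := (abs_nonneg _).trans hCs
  rw [← Real.rpow_def_of_pos hk0, Real.norm_eq_abs, abs_div, abs_mul, abs_mul, abs_abs,
    abs_of_pos hks, abs_of_pos hden]
  calc |C s| * k ^ s * |Real.log k| / (η + k ^ s)
      ≤ M * k ^ s * |Real.log k| / η := by
        gcongr
        linarith
    _ = M * |Real.log k| / η * k ^ s := by ring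

/-- For `ψ t = ((η+k^t)/(η+1))^q * exp(-∫_{tstar}^{max t tstar} C s * k^s * |log k|/(η+k^s) ds)`
and the Fano factor `D t = 1/ψ t - 1`: `ψ` is strictly decreasing on `[0,∞)`, `D` is strictly
increasing on `[0,∞)`, `D 0 = 0`, `lim_{t→∞} D t = Kt/y - 1`, the coefficient of variation
`σy t = sqrt((1 - ψ t)/y)` is increasing in `t` with `σy 0 = 0` and
`lim_{t→∞} σy t = sqrt((Kt - y)/(Kt*y))`. -/
theorem stmt_17 (q k η tstar y : ℝ) (hq : 0 < q) (hk0 : 0 < k) (hk1 : k < 1)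
    (hη : 0 < η) (htstar : 0 ≤ tstar) (hy : 0 < y)
    (C : ℝ → ℝ)
    (hC_cont : ContinuousOn C (Set.Ici tstar))
    (hC_bdd : ∃ M : ℝ, ∀ t, tstar ≤ t → |C t| ≤ M)
    (hC_pos : ∀ t, tstar < t → 0 < C t)
    (hC_zero : C tstar = 0)
    (ψ D σy : ℝ → ℝ)
    (hψ : ∀ t, ψ t = ((η + k ^ t) / (η + 1)) ^ q *
      Real.exp (-∫ s in tstar..max t tstar, C s * (k ^ s) * |Real.log k| / (η + k ^ s)))
    (hD : ∀ t, D t = 1 / ψ t - 1)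
    (hσ : ∀ t, σy t = Real.sqrt ((1 - ψ t) / y))
    (Kt : ℝ)
    (hKt : Kt = y * ((η + 1) / η) ^ q *
      Real.exp (∫ s in Set.Ioi tstar, C s * (k ^ s) * |Real.log k| / (η + k ^ s))) :
    StrictAntiOn ψ (Set.Ici 0) ∧
    StrictMonoOn D (Set.Ici 0) ∧
    D 0 = 0 ∧
    Filter.Tendsto D Filter.atTop (nhds (Kt / y - 1)) ∧
    StrictMonoOn σy (Set.Ici 0) ∧
    σy 0 = 0 ∧
    Filter.Tendsto σy Filter.atTop (nhds (Real.sqrt ((Kt - y) / (Kt * y)))) := by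
  obtain ⟨M, hM⟩ := hC_bdd
  have hint := integrableOn_mul_rpow_div_add_rpow hk0 hk1 hη hC_cont hM
  have hkpos : ∀ s : ℝ, 0 < k ^ s := fun s => Real.rpow_pos_of_pos hk0 s
  have hf0 : ∀ s, tstar < s → 0 ≤ C s * (k ^ s) * |Real.log k| / (η + k ^ s) := by
    intro s hs
    have := hkpos s
    have := hC_pos s hs
    positivity
  have hψpos : ∀ t, 0 < ψ t := by
    intro t
    have := hkpos t
    rw [hψ]
    positivity
  have hψ0 : ψ 0 = 1 := by
    have h1 : (η + 1) / (η + 1) = 1 := div_self (by positivity)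
    rw [hψ, max_eq_right htstar, Real.rpow_zero, h1]
    simp
  have hanti : StrictAnti ψ := by
    intro a b hab
    have hka := hkpos a
    have hkb := hkpos b
    have hlt : k ^ b < k ^ a := Real.rpow_lt_rpow_of_exponent_gt hk0 hk1 hab
    rw [hψ, hψ]
    refine mul_lt_mul ?_ ?_ (Real.exp_pos _) (by positivity)
    · refine Real.rpow_lt_rpow (by positivity) ?_ hq
      gcongr
    · refine Real.exp_le_exp.2 (neg_le_neg (intervalIntegral.integral_mono_interval le_rfl
        (le_max_right _ _) (max_le_max_right _ hab.le) ?_ ?_))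
      · exact (ae_restrict_iff' measurableSet_Ioc).2
          (Filter.Eventually.of_forall fun s hs => hf0 s hs.1)
      · exact (intervalIntegrable_iff_integrableOn_Ioc_of_le (le_max_right _ _)).2
          (hint.mono_set Set.Ioc_subset_Ioi_self)
  have hKpos : 0 < Kt := by
    rw [hKt]
    positivity
  have hlim : Filter.Tendsto ψ Filter.atTop (nhds (y / Kt)) := by
    have hk : Filter.Tendsto (fun t : ℝ => k ^ t) Filter.atTop (nhds 0) :=
      tendsto_rpow_atTop_of_base_lt_one k (by linarith) hk1
    have hbase : Filter.Tendsto (fun t : ℝ => ((η + k ^ t) / (η + 1)) ^ q) Filter.atTop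
        (nhds ((η / (η + 1)) ^ q)) := by
      have := (hk.const_add η).div_const (η + 1)
      rw [add_zero] at this
      exact this.rpow_const (Or.inr hq.le)
    have hmax : Filter.Tendsto (fun t : ℝ => max t tstar) Filter.atTop Filter.atTop :=
      Filter.tendsto_atTop_mono (fun t => le_max_left t tstar) Filter.tendsto_id
    have hI := intervalIntegral_tendsto_integral_Ioi tstar hint hmax
    have hprod := hbase.mul ((Real.continuous_exp.tendsto _).comp hI.neg)
    have hval : y / Kt = (η / (η + 1)) ^ q * Real.exp
        (-∫ s in Set.Ioi tstar, C s * (k ^ s) * |Real.log k| / (η + k ^ s)) := by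
      rw [hKt]
      generalize ∫ s in Set.Ioi tstar, C s * (k ^ s) * |Real.log k| / (η + k ^ s) = J
      rw [Real.exp_neg, ← inv_div (η + 1) η, Real.inv_rpow (by positivity)]
      field_simp
    rw [hval]
    exact hprod.congr fun t => (hψ t).symm
  have hL : y / Kt ≠ 0 := (div_pos hy hKpos).ne'
  refine ⟨hanti.strictAntiOn _, ?_, ?_, ?_, ?_, ?_, ?_⟩
  · intro a _ b _ hab
    rw [hD, hD]
    exact sub_lt_sub_right (one_div_lt_one_div_of_lt (hψpos b) (hanti hab)) 1
  · rw [hD, hψ0]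
    norm_num
  · have h := (hlim.inv₀ hL).sub_const 1
    rw [inv_div] at h
    exact h.congr fun t => by rw [hD, one_div]
  · intro a ha b _ hab
    have ha1 : ψ a ≤ 1 := hψ0 ▸ hanti.antitone ha
    rw [hσ, hσ]
    refine Real.sqrt_lt_sqrt (div_nonneg (sub_nonneg.2 ha1) hy.le) ?_
    have := hanti hab
    gcongr
  · rw [hσ, hψ0]
    simp
  · have h := ((hlim.const_sub 1).div_const y).sqrt
    have hval : (1 - y / Kt) / y = (Kt - y) / (Kt * y) := by
      field_simp
    rw [hval] at h
    exact h.congr fun t => (hσ t).symm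
end

section
/- Define ψ(t) = ((η+k^t)/(η+1))^q · exp(−∫_{t*}^{max(t,t*)} C(s)·k^s·|log k|/(η+k^s) ds) and, for μ > 0, φ(t) = −exp(−∫_0^t h̃_θ(u) du) + μ·∫_0^t exp(−∫_0^s h̃_θ(u) du) ds, where h̃_θ(t) = q̃(t)·k^t·|log k|/(η+k^t) with q̃(t)=q for t≤t* and q̃(t)=q+C(t) for t>t*. Then lim_{t→∞} ψ(t) is finite, lim_{t→∞} φ(t) = +∞, and consequently, for every y ∈ ℕ with y ≥ 1, the ultimate extinction probability satisfies lim_{t→∞} (1 − 1/(ψ(t)+φ(t)))^y = 1. -/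
open MeasureTheory Filter in
/-- A bounded continuous multiple of the Richards growth rate is continuous, and integrable
at infinity. -/
theorem richards_rate_integrable {k η M : ℝ} (hk0 : 0 < k) (hk1 : k < 1) (hη : 0 < η)
    {g : ℝ → ℝ} (hg : Continuous g) (hM : ∀ t, |g t| ≤ M) (a : ℝ) :
    Continuous (fun s => g s * k ^ s * |Real.log k| / (η + k ^ s)) ∧
      IntegrableOn (fun s => g s * k ^ s * |Real.log k| / (η + k ^ s)) (Set.Ioi a) := by
  have hpow : ∀ s : ℝ, 0 < k ^ s := fun s => Real.rpow_pos_of_pos hk0 s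
  have hpow_cont : Continuous (fun s : ℝ => k ^ s) := Real.continuous_const_rpow hk0.ne'
  have hcont : Continuous (fun s => g s * k ^ s * |Real.log k| / (η + k ^ s)) :=
    ((hg.mul hpow_cont).mul continuous_const).div (continuous_const.add hpow_cont)
      fun s => (add_pos hη (hpow s)).ne'
  refine ⟨hcont, ?_⟩
  have hlog : Real.log k < 0 := Real.log_neg hk0 hk1
  have hexp : IntegrableOn (fun s : ℝ => M * |Real.log k| / η * Real.exp (Real.log k * s))
      (Set.Ioi a) := (integrableOn_exp_mul_Ioi hlog a).const_mul _
  refine hexp.mono' hcont.aestronglyMeasurable (Eventually.of_forall fun s => ?_)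
  have hM0 : 0 ≤ M := (abs_nonneg _).trans (hM s)
  rw [← Real.rpow_def_of_pos hk0, Real.norm_eq_abs, abs_div, abs_mul, abs_mul, abs_abs,
    abs_of_pos (hpow s), abs_of_pos (add_pos hη (hpow s))]
  calc |g s| * k ^ s * |Real.log k| / (η + k ^ s)
      ≤ M * k ^ s * |Real.log k| / η := by
        have := hpow s
        gcongr
        · exact hM s
        · linarith
    _ = M * |Real.log k| / η * k ^ s := by ring

/-- For `ψ t = ((η+k^t)/(η+1))^q * exp(-∫_{tstar}^{max t tstar} C s * k^s * |log k|/(η+k^s) ds)`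
and, for `mu > 0`,
`φ t = -exp(-∫_0^t ht u du) + mu * ∫_0^t exp(-∫_0^s ht u du) ds`, where `ht` is the modified
growth rate: `ψ` has a finite limit at `+∞`, `φ` tends to `+∞`, and consequently, for every
natural `y ≥ 1`, the ultimate extinction probability satisfies
`lim_{t→∞} (1 - 1/(ψ t + φ t))^y = 1`. -/
theorem stmt_18 (q k η tstar mu : ℝ) (hq : 0 < q) (hk0 : 0 < k) (hk1 : k < 1)
    (hη : 0 < η) (htstar : 0 ≤ tstar) (hmu : 0 < mu)
    (C : ℝ → ℝ)
    (hC_cont : ContinuousOn C (Set.Ici tstar))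
    (hC_bdd : ∃ M : ℝ, ∀ t, tstar ≤ t → |C t| ≤ M)
    (hC_pos : ∀ t, tstar < t → 0 < C t)
    (hC_zero : C tstar = 0)
    (qt ht ψ φ : ℝ → ℝ)
    (hqt : ∀ t, qt t = if t ≤ tstar then q else q + C t)
    (hht : ∀ t, ht t = qt t * (k ^ t) * |Real.log k| / (η + k ^ t))
    (hψ : ∀ t, ψ t = ((η + k ^ t) / (η + 1)) ^ q *
      Real.exp (-∫ s in tstar..max t tstar, C s * (k ^ s) * |Real.log k| / (η + k ^ s)))
    (hφ : ∀ t, φ t = -Real.exp (-∫ u in (0:ℝ)..t, ht u) +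
      mu * ∫ s in (0:ℝ)..t, Real.exp (-∫ u in (0:ℝ)..s, ht u)) :
    (∃ L : ℝ, Filter.Tendsto ψ Filter.atTop (nhds L)) ∧
    Filter.Tendsto φ Filter.atTop Filter.atTop ∧
    ∀ y : ℕ, 1 ≤ y →
      Filter.Tendsto (fun t => (1 - 1 / (ψ t + φ t)) ^ y) Filter.atTop (nhds 1) := by
  have hpow : ∀ s : ℝ, 0 < k ^ s := fun s => Real.rpow_pos_of_pos hk0 s
  obtain ⟨M, hM⟩ := hC_bdd
  have hCm : Continuous (fun t => C (max t tstar)) :=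
    hC_cont.comp_continuous (continuous_id.max continuous_const) fun t =>
      Set.mem_Ici.mpr (le_max_right _ _)
  have hCm_bdd : ∀ t, |C (max t tstar)| ≤ M := fun t => hM _ (le_max_right _ _)
  have hCm_nonneg : ∀ t, 0 ≤ C (max t tstar) := by
    intro t
    rcases (le_max_right t tstar).eq_or_lt with h | h
    · rw [← h, hC_zero]
    · exact (hC_pos _ h).le
  have hqt' : ∀ t, qt t = q + C (max t tstar) := by
    intro t
    rw [hqt]
    split_ifs with h
    · rw [max_eq_right h, hC_zero, add_zero]
    · rw [max_eq_left (not_le.mp h).le]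
  have hht_eq : ht = fun s => (q + C (max s tstar)) * k ^ s * |Real.log k| / (η + k ^ s) := by
    funext s
    rw [hht, hqt']
  obtain ⟨hht_cont, hht_int⟩ := richards_rate_integrable
    (g := fun t => q + C (max t tstar)) (M := q + M) hk0 hk1 hη
    (continuous_const.add hCm)
    (fun t => by rw [abs_of_nonneg (add_nonneg hq.le (hCm_nonneg t))]
                 linarith [le_abs_self (C (max t tstar)), hCm_bdd t]) 0
  rw [← hht_eq] at hht_cont hht_int
  have hht_nonneg : ∀ s, 0 ≤ ht s := by
    intro s
    rw [hht_eq]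
    have := hpow s
    have := hCm_nonneg s
    positivity
  have hprim_nonneg : ∀ t, 0 ≤ t → 0 ≤ ∫ u in (0 : ℝ)..t, ht u := fun t h0 =>
    intervalIntegral.integral_nonneg h0 fun s _ => hht_nonneg s
  have hprim_le : ∀ t, 0 ≤ t → ∫ u in (0 : ℝ)..t, ht u ≤ ∫ u in Set.Ioi (0 : ℝ), ht u := by
    intro t h0
    rw [intervalIntegral.integral_of_le h0]
    exact MeasureTheory.setIntegral_mono_set hht_int
      (Filter.Eventually.of_forall hht_nonneg) (Set.Ioc_subset_Ioi_self.eventuallyLE)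
  have hexp_cont : Continuous fun s => Real.exp (-∫ u in (0 : ℝ)..s, ht u) :=
    (intervalIntegral.continuous_primitive (fun a b => hht_cont.intervalIntegrable a b)
      0).neg.rexp
  have hψ_lim : ∃ L : ℝ, Filter.Tendsto ψ Filter.atTop (nhds L) := by
    obtain ⟨-, hint⟩ := richards_rate_integrable hk0 hk1 hη hCm hCm_bdd tstar
    have hlim := MeasureTheory.intervalIntegral_tendsto_integral_Ioi tstar hint Filter.tendsto_id
    have hk : Filter.Tendsto (fun t : ℝ => k ^ t) Filter.atTop (nhds 0) :=
      tendsto_rpow_atTop_of_base_lt_one k (by linarith) hk1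
    have hbase := ((hk.const_add η).div_const (η + 1)).rpow_const (p := q) (Or.inr hq.le)
    refine ⟨_, (hbase.mul hlim.neg.rexp).congr' ?_⟩
    filter_upwards [Filter.eventually_ge_atTop tstar] with t ht'
    rw [hψ, max_eq_left ht']
    congr 3
    refine intervalIntegral.integral_congr fun s hs => ?_
    rw [id, Set.uIcc_of_le ht'] at hs
    simp only [max_eq_left hs.1]
  have hφ_lim : Filter.Tendsto φ Filter.atTop Filter.atTop := by
    set c := Real.exp (-∫ u in Set.Ioi (0 : ℝ), ht u) with hc
    have hlin : Filter.Tendsto (fun t : ℝ => -1 + mu * c * t) Filter.atTop Filter.atTop :=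
      Filter.tendsto_atTop_add_const_left _ _
        (Filter.tendsto_id.const_mul_atTop (mul_pos hmu (Real.exp_pos _)))
    refine Filter.tendsto_atTop_mono' _ ?_ hlin
    filter_upwards [Filter.eventually_ge_atTop (0 : ℝ)] with t h0
    have h1 : Real.exp (-∫ u in (0 : ℝ)..t, ht u) ≤ 1 :=
      Real.exp_le_one_iff.mpr (neg_nonpos.mpr (hprim_nonneg t h0))
    have h2 : c * t ≤ ∫ s in (0 : ℝ)..t, Real.exp (-∫ u in (0 : ℝ)..s, ht u) := by
      have := intervalIntegral.integral_mono_on (μ := MeasureTheory.volume) h0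
        (continuous_const (y := c)).continuousOn.intervalIntegrable
        (hexp_cont.intervalIntegrable 0 t)
        fun s hs => Real.exp_le_exp.mpr (neg_le_neg (hprim_le s hs.1))
      simpa [mul_comm] using this
    rw [hφ]
    have := mul_le_mul_of_nonneg_left h2 hmu.le
    linarith
  refine ⟨hψ_lim, hφ_lim, fun y _ => ?_⟩
  obtain ⟨L, hL⟩ := hψ_lim
  have hinv := (hL.add_atTop hφ_lim).inv_tendsto_atTop
  simpa using (hinv.const_sub 1).pow y
end
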